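/- For every dimension d ≥ 1, every ν > 0 and every multi-index α with |α| ≤ ν* = ⌈ν − 1⌉, there exist constants c > 0 and C₀ > 0, depending only on d and ν, with the following property. Let ψ₀ > 0, σ > 0 and n ∈ ℕ with n ψ₀² ≥ C₀ σ². Then for every choice of design points x₁, …, xₙ ∈ [-1,1]^d and every Borel-measurable estimator ĥ: ℝⁿ → C([-1,1]^d) (mapping the observed responses to a continuous function, regarded as an estimate of D^α f), there exists f ∈ C_p^ν([-1,1]^d) with ‖f‖_{C^ν} ≤ ψ₀ such that, when Y = (Y₁, …, Yₙ) with Y_i = f(x_i) + ε_i and ε₁, …, εₙ i.i.d. Gaussian with mean 0 and variance σ², the probability that sup_{x ∈ [-1,1]^d} |D^α f(x) − ĥ(Y)(x)| ≥ c · n^{−(ν−|α|)/(2ν+d)} · ψ₀^{(2|α|+d)/(2ν+d)} · σ^{(2ν−2|α|)/(2ν+d)} is at least 1/4. -/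

import Mathlib

open Real MeasureTheory Set

noncomputable section

/-- `ν* = ⌈ν - 1⌉` as a natural number. -/
def nuStar (ν : ℝ) : ℕ := (⌈ν - 1⌉).toNat

/-- Partial derivative in the `j`-th coordinate direction. -/
def pderiv {d : ℕ} (j : Fin d) (f : (Fin d → ℝ) → ℝ) : (Fin d → ℝ) → ℝ :=
  fun x => fderiv ℝ f x (Pi.single j 1)

/-- The iterated partial derivative `D^α` associated to the multi-index `α`. -/
def mDeriv {d : ℕ} (α : Fin d → ℕ) (f : (Fin d → ℝ) → ℝ) : (Fin d → ℝ) → ℝ :=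
  (List.finRange d).foldr (fun j g => (pderiv j)^[α j] g) f

/-- A multivariate trigonometric polynomial of degree at most `N` on `[-1,1]^d`: a real
linear combination of `x ↦ cos (π k·x)` and `x ↦ sin (π k·x)` over `k ∈ ℤ^d`, `‖k‖₁ ≤ N`. -/
def IsTrigPolyD (d N : ℕ) (T : (Fin d → ℝ) → ℝ) : Prop :=
  ∃ S : Finset (Fin d → ℤ), ∃ a b : (Fin d → ℤ) → ℝ,
    (∀ k ∈ S, (∑ j, (k j).natAbs) ≤ N) ∧
    ∀ x : Fin d → ℝ, T x = ∑ k ∈ S,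
      (a k * Real.cos (π * ∑ j, (k j : ℝ) * x j) + b k * Real.sin (π * ∑ j, (k j : ℝ) * x j))

/-- The box `[-1,1]^d`. -/
def box (d : ℕ) : Set (Fin d → ℝ) := Set.univ.pi fun _ => Set.Icc (-1 : ℝ) 1

/-- Sup norm over `[-1,1]^d`. -/
def supBox {d : ℕ} (g : (Fin d → ℝ) → ℝ) : ℝ := ⨆ x : box d, |g x|

/-- The Hölder condition of order `ν - ν*` (in the `ℓ^∞` norm) for the derivatives of order
`ν*`, with constant `L`. -/
def HolderCondD (ν : ℝ) {d : ℕ} (f : (Fin d → ℝ) → ℝ) (L : ℝ) : Prop :=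
  ∀ α : Fin d → ℕ, (∑ j, α j) = nuStar ν → ∀ x y : Fin d → ℝ,
    |mDeriv α f x - mDeriv α f y| ≤ L * ‖x - y‖ ^ (ν - (nuStar ν : ℝ))

/-- Membership in `C_p^ν([-1,1]^d)`: 2-periodic in each coordinate, `ν*`-times continuously
differentiable, and the order-`ν*` derivatives are `(ν - ν*)`-Hölder. -/
def MemCpD (ν : ℝ) {d : ℕ} (f : (Fin d → ℝ) → ℝ) : Prop :=
  (∀ (x : Fin d → ℝ) (j : Fin d), f (x + Pi.single j 2) = f x) ∧
  ContDiff ℝ (nuStar ν) f ∧ ∃ L : ℝ, 0 ≤ L ∧ HolderCondD ν f L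

/-- `L_ν(f)`: the least Hölder constant. -/
def holderConstD (ν : ℝ) {d : ℕ} (f : (Fin d → ℝ) → ℝ) : ℝ :=
  sInf {L : ℝ | 0 ≤ L ∧ HolderCondD ν f L}

/-- The `C^ν` norm of a periodic function: max of the sup norms (over `[-1,1]^d`) of the
derivatives `D^α f` for `|α| ≤ ν*`, and of `L_ν(f)`. -/
def CnuNormD (ν : ℝ) {d : ℕ} (f : (Fin d → ℝ) → ℝ) : ℝ :=
  max (sSup {c : ℝ | ∃ α : Fin d → ℕ, (∑ j, α j) ≤ nuStar ν ∧ c = supBox (mDeriv α f)})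
    (holderConstD ν f)

section GaussianShift

open ProbabilityTheory

theorem withDensity_apply_sq_le {Ω : Type*} [MeasurableSpace Ω] (P : Measure Ω)
    {f : Ω → ENNReal} (hf : Measurable f) {B : Set Ω} (hB : MeasurableSet B) :
    (P.withDensity f B) ^ 2 ≤ P B * ∫⁻ x, f x ^ 2 ∂P := by
  have h := ENNReal.lintegral_mul_le_Lp_mul_Lq P Real.HolderConjugate.two_two
    ((measurable_const (a := (1 : ENNReal))).indicator hB).aemeasurable hf.aemeasurable
  have h1 : ∫⁻ x, (B.indicator (fun _ => (1 : ENNReal)) * f) x ∂P = P.withDensity f B := by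
    rw [withDensity_apply _ hB, ← lintegral_indicator hB]
    congr 1 with x
    by_cases hx : x ∈ B <;> simp [hx]
  have h2 : ∫⁻ x, (B.indicator (fun _ => (1 : ENNReal)) x) ^ (2 : ℝ) ∂P = P B := by
    rw [← lintegral_indicator_one hB]
    congr 1 with x
    by_cases hx : x ∈ B <;> simp [hx]
  rw [h1, h2] at h
  calc (P.withDensity f B) ^ 2
      ≤ (P B ^ (1 / 2 : ℝ) * (∫⁻ x, f x ^ (2 : ℝ) ∂P) ^ (1 / 2 : ℝ)) ^ 2 := by gcongr
    _ = _ := by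
      rw [mul_pow, ← ENNReal.rpow_natCast, ← ENNReal.rpow_natCast, ← ENNReal.rpow_mul,
        ← ENNReal.rpow_mul]
      norm_num

theorem lintegral_pi_prod {ι : Type*} [Fintype ι] (P : ι → Measure ℝ)
    [∀ i, IsProbabilityMeasure (P i)] {g : ι → ℝ → ENNReal} (hg : ∀ i, Measurable (g i)) :
    ∫⁻ y, ∏ i, g i (y i) ∂Measure.pi P = ∏ i, ∫⁻ t, g i t ∂P i := by
  have hind : iIndepFun (fun i (y : ι → ℝ) => g i (y i)) (Measure.pi P) :=
    iIndepFun_pi (X := g) fun i => (hg i).aemeasurable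
  rw [lintegral_prod_eq_prod_lintegral_of_indepFun Finset.univ _ hind
    fun i => (hg i).comp (measurable_pi_apply i)]
  refine Finset.prod_congr rfl fun i _ => ?_
  rw [← (measurePreserving_eval P i).map_eq, lintegral_map (hg i) (measurable_pi_apply i)]

theorem pi_withDensity {ι : Type*} [Fintype ι] (P : ι → Measure ℝ)
    [∀ i, IsProbabilityMeasure (P i)] {g : ι → ℝ → ENNReal} (hg : ∀ i, Measurable (g i))
    [∀ i, SigmaFinite ((P i).withDensity (g i))] :
    Measure.pi (fun i => (P i).withDensity (g i)) =
      (Measure.pi P).withDensity fun y => ∏ i, g i (y i) := by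
  refine Measure.pi_eq fun s hs => ?_
  rw [withDensity_apply _ (MeasurableSet.univ_pi hs),
    ← lintegral_indicator (MeasurableSet.univ_pi hs)]
  rw [Finset.prod_congr rfl fun i _ => (withDensity_apply (g i) (hs i)).trans
    (lintegral_indicator (hs i) _).symm]
  rw [← lintegral_pi_prod P fun i => (hg i).indicator (hs i)]
  congr 1 with y
  by_cases hy : y ∈ univ.pi s
  · rw [indicator_of_mem hy]
    exact Finset.prod_congr rfl fun i _ => (indicator_of_mem (hy i (mem_univ i)) _).symm
  · rw [indicator_of_notMem hy]
    simp only [mem_univ_pi, not_forall] at hy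
    obtain ⟨i, hi⟩ := hy
    exact (Finset.prod_eq_zero (Finset.mem_univ i) (indicator_of_notMem hi _)).symm

theorem gaussianReal_eq_withDensity (μ : ℝ) {v : NNReal} (hv : v ≠ 0) :
    gaussianReal μ v = (gaussianReal 0 v).withDensity
      fun y => ENNReal.ofReal (exp (μ / v * y - μ ^ 2 / (2 * v))) := by
  rw [gaussianReal_of_var_ne_zero μ hv, gaussianReal_of_var_ne_zero 0 hv,
    ← withDensity_mul _ (measurable_gaussianPDF 0 v) (by fun_prop)]
  congr 1 with y
  rw [Pi.mul_apply, gaussianPDF, gaussianPDF, ← ENNReal.ofReal_mul (gaussianPDFReal_nonneg _ _ _),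
    gaussianPDFReal, gaussianPDFReal, mul_assoc (√(2 * π * v))⁻¹, ← exp_add]
  have : (v : ℝ) ≠ 0 := by exact_mod_cast hv
  congr 4
  field_simp
  ring

theorem lintegral_gaussian_likelihood_sq (μ : ℝ) {v : NNReal} (hv : v ≠ 0) :
    ∫⁻ y, ENNReal.ofReal (exp (μ / v * y - μ ^ 2 / (2 * v))) ^ 2 ∂gaussianReal 0 v =
      ENNReal.ofReal (exp (μ ^ 2 / v)) := by
  have hv' : (v : ℝ) ≠ 0 := by exact_mod_cast hv
  have h (y : ℝ) : ENNReal.ofReal (exp (μ / v * y - μ ^ 2 / (2 * v))) ^ 2 =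
      ENNReal.ofReal (exp (-(μ ^ 2 / v)) * exp (2 * μ / v * y)) := by
    rw [← ENNReal.ofReal_pow (exp_nonneg _), ← exp_nat_mul, ← exp_add]
    congr 2
    push_cast
    field_simp
    ring
  simp_rw [h]
  rw [← ofReal_integral_eq_lintegral_ofReal
    ((integrable_exp_mul_gaussianReal _).const_mul _) (ae_of_all _ fun y => by positivity),
    integral_const_mul]
  have := congrFun (mgf_id_gaussianReal (μ := 0) (v := v)) (2 * μ / v)
  simp only [mgf, id] at this
  rw [this, ← exp_add]
  congr 2
  field_simp
  ring

theorem pi_gaussianReal_apply_sq_le {n : ℕ} (μ : Fin n → ℝ) {v : NNReal} (hv : v ≠ 0)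
    {B : Set (Fin n → ℝ)} (hB : MeasurableSet B) :
    (Measure.pi (fun i => gaussianReal (μ i) v) B) ^ 2 ≤
      Measure.pi (fun _ : Fin n => gaussianReal 0 v) B *
        ENNReal.ofReal (exp ((∑ i, μ i ^ 2) / v)) := by
  have hm (i : Fin n) :
      Measurable fun y => ENNReal.ofReal (exp (μ i / v * y - μ i ^ 2 / (2 * v))) := by fun_prop
  have hsf (i : Fin n) : SigmaFinite ((gaussianReal 0 v).withDensity
      fun y => ENNReal.ofReal (exp (μ i / v * y - μ i ^ 2 / (2 * v)))) := by
    rw [← gaussianReal_eq_withDensity _ hv]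
    infer_instance
  simp_rw [fun i => gaussianReal_eq_withDensity (μ i) hv]
  rw [pi_withDensity _ hm]
  refine (withDensity_apply_sq_le _ (by fun_prop) hB).trans_eq ?_
  simp_rw [← Finset.prod_pow]
  rw [lintegral_pi_prod (fun _ : Fin n => gaussianReal 0 v) fun i => (hm i).pow_const 2]
  simp_rw [fun i => lintegral_gaussian_likelihood_sq (μ i) hv]
  rw [← ENNReal.ofReal_prod_of_nonneg fun _ _ => exp_nonneg _, ← exp_sum, Finset.sum_div]

theorem two_point_gaussian {n : ℕ} (μ : Fin n → ℝ) {v : NNReal} (hv : v ≠ 0)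
    (hμ : (∑ i, μ i ^ 2) / v ≤ 1 / 4) {E₀ E₁ : Set (Fin n → ℝ)}
    (h₀ : MeasurableSet E₀) (hE : E₀ ∪ E₁ = univ) :
    1 / 4 ≤ Measure.pi (fun _ : Fin n => gaussianReal 0 v) E₀ ∨
      1 / 4 ≤ Measure.pi (fun i => gaussianReal (μ i) v) E₁ := by
  by_contra! ⟨hlt₀, hlt₁⟩
  set P := Measure.pi fun _ : Fin n => gaussianReal 0 v
  set Q := Measure.pi fun i => gaussianReal (μ i) v
  have hsq : Q E₀ ^ 2 ≤ P E₀ * ENNReal.ofReal (exp ((∑ i, μ i ^ 2) / v)) :=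
    pi_gaussianReal_apply_sq_le μ hv h₀
  have hone : 1 ≤ Q E₀ + Q E₁ := by
    rw [← measure_univ (μ := Q), ← hE]
    exact measure_union_le _ _
  have hexp : exp ((∑ i, μ i ^ 2) / v) ≤ 2 := by
    rw [← Real.le_log_iff_exp_le two_pos]
    linarith [Real.log_two_gt_d9]
  have hsq' : Q.real E₀ ^ 2 ≤ P.real E₀ * exp ((∑ i, μ i ^ 2) / v) := by
    have := ENNReal.toReal_mono (by finiteness) hsq
    simpa [measureReal_def, ENNReal.toReal_mul, ENNReal.toReal_ofReal (exp_nonneg _)] using this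
  have hone' : 1 ≤ Q.real E₀ + Q.real E₁ := by
    have := ENNReal.toReal_mono (by finiteness) hone
    rwa [ENNReal.toReal_add (by finiteness) (by finiteness), ENNReal.toReal_one] at this
  have hP : P.real E₀ < 1 / 4 := by
    have := ENNReal.toReal_strict_mono (by finiteness) hlt₀
    simpa [measureReal_def] using this
  have hQ : Q.real E₁ < 1 / 4 := by
    have := ENNReal.toReal_strict_mono (by finiteness) hlt₁
    simpa [measureReal_def] using this
  have : P.real E₀ * exp ((∑ i, μ i ^ 2) / v) ≤ P.real E₀ * 2 := by gcongr
  nlinarith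

end GaussianShift

/-- The function on `ℝ` obtained by repeating `b (m * ·)`, restricted to `[0, 2]`, with period `2`
from the origin `2 * τ`. -/
def periodize (m τ : ℝ) (b : ℝ → ℝ) (t : ℝ) : ℝ := b (2 * m * Int.fract (t / 2 - τ))

theorem periodize_add_two (m τ : ℝ) (b : ℝ → ℝ) (t : ℝ) :
    periodize m τ b (t + 2) = periodize m τ b t := by
  unfold periodize
  rw [show (t + 2) / 2 - τ = t / 2 - τ + 1 by ring, Int.fract_add_one]

theorem hasDerivAt_periodize {m : ℝ} (hm : 1 ≤ m) (τ : ℝ) {b b' : ℝ → ℝ}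
    (hb : ∀ t, HasDerivAt b (b' t) t) (hsupp : ∀ t ∉ Icc (1 / 2 : ℝ) (3 / 2), b t = 0) (t : ℝ) :
    HasDerivAt (periodize m τ b) (m * periodize m τ b' t) t := by
  set k := ⌊t / 2 - τ⌋ with hk
  have hloc : periodize m τ b =ᶠ[nhds t] fun s => b (2 * m * (s / 2 - τ - k)) := by
    have hnhds : (fun s : ℝ => s / 2 - τ) ⁻¹' Ioo (k - 1 / 4 : ℝ) (k + 1) ∈ nhds t := by
      refine (isOpen_Ioo.preimage (by fun_prop)).mem_nhds ⟨?_, Int.lt_floor_add_one _⟩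
      have := Int.floor_le (t / 2 - τ)
      linarith
    filter_upwards [hnhds] with s hs
    obtain ⟨hs₁, hs₂⟩ := hs
    unfold periodize
    by_cases h : (k : ℝ) ≤ s / 2 - τ
    · rw [Int.fract, Int.floor_eq_iff.2 ⟨h, hs₂⟩]
    · push Not at h
      have hfl : ⌊s / 2 - τ⌋ = k - 1 :=
        Int.floor_eq_iff.2 ⟨by push_cast; linarith, by push_cast; linarith⟩
      rw [Int.fract, hfl, hsupp, hsupp]
      · rintro ⟨h₁, -⟩
        nlinarith
      · rintro ⟨-, h₂⟩
        push_cast at h₂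
        nlinarith
  refine HasDerivAt.congr_of_eventuallyEq ?_ hloc
  have haff : HasDerivAt (fun s : ℝ => 2 * m * (s / 2 - τ - k)) m t := by
    have := ((((hasDerivAt_id t).div_const 2).sub_const τ).sub_const (k : ℝ)).const_mul (2 * m)
    refine this.congr_deriv ?_
    ring
  have := (hb (2 * m * (t / 2 - τ - k))).comp t haff
  refine this.congr_deriv ?_
  rw [mul_comm]
  rfl

theorem exists_bump_derivatives : ∃ b : ℕ → ℝ → ℝ,
    (∀ k t, HasDerivAt (b k) (b (k + 1) t) t) ∧
    (∀ k, ∀ t ∉ Icc (1 / 2 : ℝ) (3 / 2), b k t = 0) ∧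
    (∀ k, ∃ u ∈ Icc (1 / 2 : ℝ) (3 / 2), b k u ≠ 0) ∧
    ∀ N : ℕ, ∃ M : ℝ, 1 ≤ M ∧ ∀ k ≤ N, ∀ t, |b k t| ≤ M := by
  let f : ContDiffBump (1 : ℝ) := ⟨1 / 4, 1 / 2, by norm_num, by norm_num⟩
  have hder (k : ℕ) (t : ℝ) :
      HasDerivAt (iteratedDeriv k f) (iteratedDeriv (k + 1) f t) t := by
    rw [iteratedDeriv_succ]
    have hdiff : Differentiable ℝ (iteratedDeriv k f) :=
      (f.contDiff (n := (⊤ : ℕ∞))).differentiable_iteratedDeriv k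
        (by exact_mod_cast ENat.natCast_lt_top k)
    exact (hdiff t).hasDerivAt
  have hsupp (k : ℕ) : ∀ t ∉ Icc (1 / 2 : ℝ) (3 / 2), iteratedDeriv k f t = 0 := by
    induction k with
    | zero =>
      intro t ht
      rw [iteratedDeriv_zero]
      refine f.zero_of_le_dist ?_
      rw [Real.dist_eq, le_abs]
      change 1 / 2 ≤ _ ∨ 1 / 2 ≤ _
      simp only [mem_Icc, not_and_or, not_le] at ht
      rcases ht with ht | ht
      · right; linarith
      · left; linarith
    | succ k ih =>
      intro t ht
      rw [← (hder k t).deriv]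
      have : iteratedDeriv k f =ᶠ[nhds t] fun _ => 0 := by
        filter_upwards [isClosed_Icc.isOpen_compl.mem_nhds ht] with s hs using ih s hs
      rw [this.deriv_eq, deriv_const]
  have hne (k : ℕ) : ∃ u, iteratedDeriv k f u ≠ 0 := by
    induction k with
    | zero => exact ⟨1, by
        rw [iteratedDeriv_zero, f.one_of_mem_closedBall (Metric.mem_closedBall_self f.rIn_pos.le)]
        exact one_ne_zero⟩
    | succ k ih =>
      by_contra! h
      obtain ⟨u, hu⟩ := ih
      refine hu ?_
      rw [is_const_of_deriv_eq_zero (fun t => (hder k t).differentiableAt)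
        (fun t => (hder k t).deriv.trans (h t)) u 0]
      exact hsupp k 0 (by norm_num)
  refine ⟨fun k => iteratedDeriv k f, hder, hsupp, fun k => ?_, fun N => ?_⟩
  · obtain ⟨u, hu⟩ := hne k
    exact ⟨u, by_contra fun h => hu (hsupp k u h), hu⟩
  · have hbdd (k : ℕ) : ∃ C, ∀ t, |iteratedDeriv k f t| ≤ C :=
      (continuous_iff_continuousAt.2 fun t =>
        (hder k t).continuousAt).bounded_above_of_compact_support
        (HasCompactSupport.intro isCompact_Icc (hsupp k))
    choose C hC using hbdd
    refine ⟨1 + ∑ k ∈ Finset.range (N + 1), |C k|, ?_, fun k hk t => ?_⟩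
    · have : 0 ≤ ∑ k ∈ Finset.range (N + 1), |C k| := by positivity
      linarith
    · have := Finset.single_le_sum (f := fun k => |C k|) (fun _ _ => abs_nonneg _)
        (Finset.mem_range.2 (Nat.lt_succ_of_le hk))
      have := le_abs_self (C k)
      linarith [hC k t]

theorem pderiv_prod {d : ℕ} {Φ : Fin d → ℕ → ℝ → ℝ} {m : ℝ}
    (hΦ : ∀ j k t, HasDerivAt (Φ j k) (m * Φ j (k + 1) t) t) (A : ℝ) (κ : Fin d → ℕ) (j : Fin d) :
    pderiv j (fun x => A * ∏ i, Φ i (κ i) (x i)) =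
      fun x => A * m * ∏ i, Φ i ((κ + Pi.single j 1 : Fin d → ℕ) i) (x i) := by
  ext x
  have h (i : Fin d) : HasFDerivAt (fun x : Fin d → ℝ => Φ i (κ i) (x i))
      ((m * Φ i (κ i + 1) (x i)) • ContinuousLinearMap.proj (R := ℝ) (φ := fun _ => ℝ) i) x :=
    (hΦ i (κ i) (x i)).comp_hasFDerivAt x (hasFDerivAt_apply i x)
  have hp := (HasFDerivAt.finsetProd (u := Finset.univ) fun i _ => h i).const_mul A
  rw [pderiv, hp.fderiv]
  simp only [smul_apply, sum_apply,
    ContinuousLinearMap.proj_apply, smul_eq_mul]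
  rw [Finset.sum_eq_single j (fun i _ hij => by simp [hij])
    (fun hj => absurd (Finset.mem_univ j) hj),
    ← Finset.mul_prod_erase Finset.univ _ (Finset.mem_univ j)]
  have : ∏ i ∈ Finset.univ.erase j, Φ i ((κ + Pi.single j 1 : Fin d → ℕ) i) (x i) =
      ∏ i ∈ Finset.univ.erase j, Φ i (κ i) (x i) :=
    Finset.prod_congr rfl fun i hi => by simp [Finset.ne_of_mem_erase hi]
  rw [this]
  simp only [Pi.add_apply, Pi.single_eq_same]
  ring

theorem pderiv_iterate_prod {d : ℕ} {Φ : Fin d → ℕ → ℝ → ℝ} {m : ℝ}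
    (hΦ : ∀ j k t, HasDerivAt (Φ j k) (m * Φ j (k + 1) t) t) (A : ℝ) (κ : Fin d → ℕ) (j : Fin d)
    (r : ℕ) :
    (pderiv j)^[r] (fun x => A * ∏ i, Φ i (κ i) (x i)) =
      fun x => A * m ^ r * ∏ i, Φ i ((κ + Pi.single j r : Fin d → ℕ) i) (x i) := by
  induction r with
  | zero => simp
  | succ r ih =>
    rw [Function.iterate_succ_apply', ih, pderiv_prod hΦ, add_assoc, ← Pi.single_add]
    simp only [pow_succ, mul_assoc]

theorem mDeriv_prod {d : ℕ} {Φ : Fin d → ℕ → ℝ → ℝ} {m : ℝ}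
    (hΦ : ∀ j k t, HasDerivAt (Φ j k) (m * Φ j (k + 1) t) t) (A : ℝ) (β : Fin d → ℕ) :
    mDeriv β (fun x => A * ∏ i, Φ i 0 (x i)) =
      fun x => A * m ^ (∑ j, β j) * ∏ i, Φ i (β i) (x i) := by
  have h (l : List (Fin d)) :
      l.foldr (fun j g => (pderiv j)^[β j] g) (fun x => A * ∏ i, Φ i 0 (x i)) =
        fun x => A * m ^ (l.map β).sum *
          ∏ i, Φ i ((l.map fun j => Pi.single j (β j)).sum i) (x i) := by
    induction l with
    | nil => simp
    | cons j l ih =>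
      rw [List.foldr_cons, ih, pderiv_iterate_prod hΦ]
      simp only [List.map_cons, List.sum_cons, mul_assoc, ← pow_add]
      simp only [add_comm]
  rw [mDeriv, h, ← Fin.sum_univ_def, ← Fin.sum_univ_def, Finset.univ_sum_single]

theorem abs_prod_sub_prod_le {ι : Type*} (s : Finset ι) {a b : ι → ℝ} {M δ : ℝ} (hM : 1 ≤ M)
    (ha : ∀ i ∈ s, |a i| ≤ M) (hb : ∀ i ∈ s, |b i| ≤ M) (hab : ∀ i ∈ s, |a i - b i| ≤ δ) :
    |∏ i ∈ s, a i - ∏ i ∈ s, b i| ≤ s.card * M ^ s.card * δ := by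
  classical
  induction s using Finset.induction_on with
  | empty => simp
  | insert i s hi ih =>
    have ih' := ih (fun j hj => ha j (Finset.mem_insert_of_mem hj))
      (fun j hj => hb j (Finset.mem_insert_of_mem hj))
      (fun j hj => hab j (Finset.mem_insert_of_mem hj))
    have hai := ha i (Finset.mem_insert_self i s)
    have habi := hab i (Finset.mem_insert_self i s)
    have hδ : 0 ≤ δ := (abs_nonneg _).trans habi
    have hprod : |∏ j ∈ s, b j| ≤ M ^ s.card := by
      rw [Finset.abs_prod]
      exact (Finset.prod_le_prod (fun _ _ => abs_nonneg _)
        fun j hj => hb j (Finset.mem_insert_of_mem hj)).trans_eq (by simp)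
    have hpow : M ^ s.card ≤ M ^ (s.card + 1) := pow_le_pow_right₀ hM (Nat.le_succ _)
    rw [Finset.prod_insert hi, Finset.prod_insert hi, Finset.card_insert_of_notMem hi]
    calc |a i * ∏ j ∈ s, a j - b i * ∏ j ∈ s, b j|
        = |a i * (∏ j ∈ s, a j - ∏ j ∈ s, b j) + (a i - b i) * ∏ j ∈ s, b j| := by ring_nf
      _ ≤ |a i| * |∏ j ∈ s, a j - ∏ j ∈ s, b j| + |a i - b i| * |∏ j ∈ s, b j| := by
          rw [← abs_mul, ← abs_mul]
          exact abs_add_le _ _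
      _ ≤ M * (s.card * M ^ s.card * δ) + δ * M ^ (s.card + 1) := by
          gcongr
          exact hprod.trans hpow
      _ = _ := by push_cast; ring

theorem nuStar_lt {ν : ℝ} (hν : 0 < ν) : (nuStar ν : ℝ) < ν := by
  have h0 : 0 ≤ ⌈ν - 1⌉ := by
    rw [← Int.sub_one_lt_iff, Int.lt_ceil]
    push_cast
    linarith
  have : ((nuStar ν : ℤ) : ℝ) = ⌈ν - 1⌉ := by rw [nuStar, Int.toNat_of_nonneg h0]
  rw [Int.cast_natCast] at this
  rw [this]
  linarith [Int.ceil_lt_add_one (ν - 1)]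

theorem sub_nuStar_le_one (ν : ℝ) : ν - nuStar ν ≤ 1 := by
  have h : ((⌈ν - 1⌉ : ℤ) : ℝ) ≤ ((nuStar ν : ℤ) : ℝ) := by
    exact_mod_cast Int.self_le_toNat _
  rw [Int.cast_natCast] at h
  linarith [Int.le_ceil (ν - 1)]

theorem supBox_le {d : ℕ} {g : (Fin d → ℝ) → ℝ} {C : ℝ} (hC : 0 ≤ C) (h : ∀ x, |g x| ≤ C) :
    supBox g ≤ C :=
  Real.iSup_le (fun x => h x) hC

theorem le_supBox {d : ℕ} {g : (Fin d → ℝ) → ℝ} (hg : Continuous g) {x : Fin d → ℝ}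
    (hx : x ∈ box d) : |g x| ≤ supBox g := by
  have hbox : IsCompact (box d) := isCompact_univ_pi fun _ => isCompact_Icc
  have hbdd : BddAbove (range fun y : box d => |g y|) := by
    have := hbox.bddAbove_image hg.abs.continuousOn
    rwa [image_eq_range] at this
  exact le_ciSup hbdd ⟨x, hx⟩

theorem le_mul_rpow_of_le_of_le_mul {s γ K u : ℝ} (hs : 0 ≤ s) (hγ₀ : 0 < γ) (hγ₁ : γ ≤ 1)
    (hK : 0 ≤ K)
    (h₁ : u ≤ K) (h₂ : u ≤ K * s) : u ≤ K * s ^ γ := by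
  rcases le_total s 1 with h | h
  · refine h₂.trans ?_
    gcongr
    rcases hs.eq_or_lt with rfl | hs
    · exact Real.rpow_nonneg le_rfl _
    · simpa using Real.rpow_le_rpow_of_exponent_ge hs h hγ₁
  · exact h₁.trans (le_mul_of_one_le_right hK (Real.one_le_rpow h hγ₀.le))

section ProductFunctions

variable {d : ℕ} {Φ : Fin d → ℕ → ℝ → ℝ} {m M ν : ℝ}

theorem abs_prod_le_pow (hbd : ∀ j, ∀ k ≤ nuStar ν + 1, ∀ t, |Φ j k t| ≤ M)
    {β : Fin d → ℕ} (hβ : ∑ j, β j ≤ nuStar ν) (x : Fin d → ℝ) :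
    |∏ i, Φ i (β i) (x i)| ≤ M ^ d := by
  have hle (i : Fin d) : β i ≤ nuStar ν + 1 :=
    ((Finset.single_le_sum (fun _ _ => Nat.zero_le _) (Finset.mem_univ i)).trans hβ).trans
      (Nat.le_succ _)
  rw [Finset.abs_prod]
  exact (Finset.prod_le_prod (fun _ _ => abs_nonneg _) fun i _ => hbd i _ (hle i) _).trans_eq
    (by simp)

theorem abs_prod_sub_le_rpow (hd : 1 ≤ d) (hν : 0 < ν) (hm : 1 ≤ m) (hM : 1 ≤ M)
    (hΦ : ∀ j k t, HasDerivAt (Φ j k) (m * Φ j (k + 1) t) t)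
    (hbd : ∀ j, ∀ k ≤ nuStar ν + 1, ∀ t, |Φ j k t| ≤ M)
    {β : Fin d → ℕ} (hβ : ∑ j, β j ≤ nuStar ν) (x y : Fin d → ℝ) :
    |∏ i, Φ i (β i) (x i) - ∏ i, Φ i (β i) (y i)| ≤
      2 * d * M ^ (d + 1) * (m * ‖x - y‖) ^ (ν - nuStar ν) := by
  have hd' : (1 : ℝ) ≤ d := by exact_mod_cast hd
  have hle (i : Fin d) : β i ≤ nuStar ν :=
    (Finset.single_le_sum (fun _ _ => Nat.zero_le _) (Finset.mem_univ i)).trans hβ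
  have hpow : M ^ d ≤ M ^ (d + 1) := pow_le_pow_right₀ hM (Nat.le_succ _)
  have hpos : 0 ≤ M ^ d := by positivity
  refine le_mul_rpow_of_le_of_le_mul (by positivity) (sub_pos.2 (nuStar_lt hν))
    (sub_nuStar_le_one ν) (by positivity) ?_ ?_
  · have h := abs_sub (∏ i, Φ i (β i) (x i)) (∏ i, Φ i (β i) (y i))
    have hx := abs_prod_le_pow hbd hβ x
    have hy := abs_prod_le_pow hbd hβ y
    nlinarith
  · have hlip (i : Fin d) :
        |Φ i (β i) (x i) - Φ i (β i) (y i)| ≤ m * M * ‖x - y‖ := by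
      have := Convex.norm_image_sub_le_of_norm_hasDerivWithin_le (C := m * M)
        (fun t _ => (hΦ i (β i) t).hasDerivWithinAt)
        (fun t _ => by
          rw [norm_mul, Real.norm_of_nonneg (zero_le_one.trans hm)]
          gcongr
          exact hbd i _ (Nat.succ_le_succ (hle i)) t)
        convex_univ (mem_univ (y i)) (mem_univ (x i))
      refine this.trans ?_
      gcongr
      exact norm_le_pi_norm (x - y) i
    have := abs_prod_sub_prod_le Finset.univ hM
      (fun i _ => hbd i (β i) ((hle i).trans (Nat.le_succ _)) (x i))
      (fun i _ => hbd i (β i) ((hle i).trans (Nat.le_succ _)) (y i))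
      (fun i _ => hlip i)
    rw [Finset.card_univ, Fintype.card_fin] at this
    refine this.trans ?_
    have h0 : 0 ≤ d * M ^ (d + 1) * (m * ‖x - y‖) := by positivity
    calc d * M ^ d * (m * M * ‖x - y‖) = d * M ^ (d + 1) * (m * ‖x - y‖) := by ring
      _ ≤ 2 * (d * M ^ (d + 1) * (m * ‖x - y‖)) := by linarith
      _ = _ := by ring

theorem continuous_prod (hΦ : ∀ j k t, HasDerivAt (Φ j k) (m * Φ j (k + 1) t) t) (A : ℝ)
    (κ : Fin d → ℕ) : Continuous fun x : Fin d → ℝ => A * ∏ i, Φ i (κ i) (x i) := by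
  have h (i : Fin d) : Continuous (Φ i (κ i)) :=
    continuous_iff_continuousAt.2 fun t => (hΦ i (κ i) t).continuousAt
  fun_prop

theorem contDiff_of_hasDerivAt_succ {φ : ℕ → ℝ → ℝ}
    (hφ : ∀ k t, HasDerivAt (φ k) (m * φ (k + 1) t) t) (n k : ℕ) : ContDiff ℝ n (φ k) := by
  induction n generalizing k with
  | zero => exact contDiff_zero.2 (continuous_iff_continuousAt.2 fun t => (hφ k t).continuousAt)
  | succ n ih =>
    rw [Nat.cast_add, Nat.cast_one, contDiff_succ_iff_deriv]
    refine ⟨fun t => (hφ k t).differentiableAt, by simp, ?_⟩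
    rw [show deriv (φ k) = fun t => m * φ (k + 1) t from funext fun t => (hφ k t).deriv]
    exact contDiff_const.mul (ih (k + 1))

theorem memCpD_prod (hd : 1 ≤ d) (hν : 0 < ν) (hm : 1 ≤ m) (hM : 1 ≤ M)
    (hΦ : ∀ j k t, HasDerivAt (Φ j k) (m * Φ j (k + 1) t) t)
    (hbd : ∀ j, ∀ k ≤ nuStar ν + 1, ∀ t, |Φ j k t| ≤ M)
    (hper : ∀ j t, Φ j 0 (t + 2) = Φ j 0 t) {A ψ : ℝ}
    (hA : |A| * (2 * d * M ^ (d + 1)) * m ^ ν ≤ ψ) :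
    MemCpD ν (fun x => A * ∏ i, Φ i 0 (x i)) ∧
      CnuNormD ν (fun x => A * ∏ i, Φ i 0 (x i)) ≤ ψ := by
  have hm0 : 0 < m := zero_lt_one.trans_le hm
  have hd' : (1 : ℝ) ≤ d := by exact_mod_cast hd
  have hψ : 0 ≤ ψ := le_trans (by positivity) hA
  have hholder : HolderCondD ν (fun x => A * ∏ i, Φ i 0 (x i)) ψ := by
    intro β hβ x y
    simp only [mDeriv_prod hΦ, hβ]
    rw [← mul_sub, abs_mul, abs_mul, abs_of_nonneg (pow_nonneg hm0.le _)]
    calc |A| * m ^ nuStar ν * |∏ i, Φ i (β i) (x i) - ∏ i, Φ i (β i) (y i)|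
        ≤ |A| * m ^ nuStar ν *
            (2 * d * M ^ (d + 1) * (m * ‖x - y‖) ^ (ν - nuStar ν)) := by
          gcongr
          exact abs_prod_sub_le_rpow hd hν hm hM hΦ hbd hβ.le x y
      _ = |A| * (2 * d * M ^ (d + 1)) * (m ^ (nuStar ν : ℝ) * m ^ (ν - nuStar ν)) *
            ‖x - y‖ ^ (ν - nuStar ν) := by
          rw [Real.mul_rpow hm0.le (norm_nonneg _), Real.rpow_natCast]
          ring
      _ ≤ ψ * ‖x - y‖ ^ (ν - nuStar ν) := by
          rw [← Real.rpow_add hm0, add_sub_cancel]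
          gcongr
  refine ⟨⟨fun x j => ?_, ?_, ψ, hψ, hholder⟩, max_le (Real.sSup_le ?_ hψ) ?_⟩
  · refine congrArg (A * ·) (Finset.prod_congr rfl fun i _ => ?_)
    by_cases hij : i = j
    · subst hij
      simpa using hper i (x i)
    · simp [hij]
  · refine contDiff_const.mul (contDiff_prod fun i _ => ?_)
    exact (contDiff_of_hasDerivAt_succ (hΦ i) _ 0).comp (contDiff_apply ℝ ℝ i)
  · rintro _ ⟨β, hβ, rfl⟩
    refine supBox_le hψ fun x => ?_
    rw [mDeriv_prod hΦ, abs_mul, abs_mul, abs_of_nonneg (pow_nonneg hm0.le _)]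
    have hprod : |∏ i, Φ i (β i) (x i)| ≤ 2 * d * M ^ (d + 1) := by
      have hpow : M ^ d ≤ M ^ (d + 1) := pow_le_pow_right₀ hM (Nat.le_succ _)
      have hpos : 0 ≤ M ^ d := by positivity
      have := abs_prod_le_pow hbd hβ x
      nlinarith
    have hmν : m ^ (∑ j, β j) ≤ m ^ ν := by
      rw [← Real.rpow_natCast]
      refine Real.rpow_le_rpow_of_exponent_le hm (le_trans ?_ (nuStar_lt hν).le)
      exact_mod_cast hβ
    calc |A| * m ^ (∑ j, β j) * |∏ i, Φ i (β i) (x i)|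
        ≤ |A| * m ^ ν * (2 * d * M ^ (d + 1)) := by gcongr
      _ = |A| * (2 * d * M ^ (d + 1)) * m ^ ν := by ring
      _ ≤ ψ := hA
  · exact csInf_le ⟨0, fun L hL => hL.1⟩ ⟨hψ, hholder⟩

end ProductFunctions

theorem periodize_cell_unique {m : ℕ} {b : ℝ → ℝ}
    (hsupp : ∀ t ∉ Icc (1 / 2 : ℝ) (3 / 2), b t = 0) {t : ℝ} {i j : Fin m}
    (hi : periodize m (i / m - 1 / 2) b t ≠ 0) (hj : periodize m (j / m - 1 / 2) b t ≠ 0) :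
    i = j := by
  have hm : (m : ℝ) ≠ 0 := Nat.cast_ne_zero.2 (Fin.pos i).ne'
  have hi' := by_contra fun h => hi (hsupp _ h)
  have hj' := by_contra fun h => hj (hsupp _ h)
  rw [Int.fract] at hi' hj'
  set p := ⌊t / 2 - (i / m - 1 / 2 : ℝ)⌋
  set q := ⌊t / 2 - (j / m - 1 / 2 : ℝ)⌋
  have ei : 2 * (m : ℝ) * (t / 2 - (i / m - 1 / 2) - p) = m * t + m - 2 * i - 2 * m * p := by
    field_simp
    ring
  have ej : 2 * (m : ℝ) * (t / 2 - (j / m - 1 / 2) - q) = m * t + m - 2 * j - 2 * m * q := by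
    field_simp
    ring
  rw [ei] at hi'
  rw [ej] at hj'
  obtain ⟨hi₁, hi₂⟩ := hi'
  obtain ⟨hj₁, hj₂⟩ := hj'
  have h₁ : ((i : ℕ) : ℤ) + m * p - (j + m * q) < 1 := by
    have : ((i : ℕ) : ℝ) + m * p - (j + m * q) < 1 := by linarith
    exact_mod_cast this
  have h₂ : -1 < ((i : ℕ) : ℤ) + m * p - (j + m * q) := by
    have : -1 < ((i : ℕ) : ℝ) + m * p - (j + m * q) := by linarith
    exact_mod_cast this
  have h : ((i : ℕ) : ℤ) + m * p = j + m * q := by omega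
  have hmod : ((i : ℕ) : ℤ) % m = (j : ℕ) % m := by
    rw [← Int.add_mul_emod_self_left i m p, h, Int.add_mul_emod_self_left]
  rw [Int.emod_eq_of_lt (by positivity) (by exact_mod_cast i.2),
    Int.emod_eq_of_lt (by positivity) (by exact_mod_cast j.2)] at hmod
  exact Fin.ext (by exact_mod_cast hmod)

theorem sum_periodize_sq_le {m : ℕ} {b : ℝ → ℝ} {M : ℝ}
    (hsupp : ∀ t ∉ Icc (1 / 2 : ℝ) (3 / 2), b t = 0) (hM : ∀ t, |b t| ≤ M) (t : ℝ) :
    ∑ i : Fin m, periodize m (i / m - 1 / 2) b t ^ 2 ≤ M ^ 2 := by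
  by_cases h : ∃ i : Fin m, periodize m (i / m - 1 / 2) b t ≠ 0
  · obtain ⟨i, hi⟩ := h
    rw [Finset.sum_eq_single i (fun j _ hji => ?_) (fun hi => absurd (Finset.mem_univ i) hi)]
    · exact sq_le_sq' (neg_le_of_abs_le (hM _)) (le_of_abs_le (hM _))
    · by_contra hj
      exact hji (periodize_cell_unique hsupp (ne_of_apply_ne (· ^ 2) (by simpa using hj)) hi)
  · push Not at h
    rw [Finset.sum_eq_zero fun i _ => by rw [h i, zero_pow two_ne_zero]]
    positivity

/-- Among the `m ^ d` cells there is one carrying at most its share of the design points. -/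
theorem exists_sparse_cell {d n m : ℕ} (hm : 0 < m) {b : ℝ → ℝ} {M : ℝ}
    (hsupp : ∀ t ∉ Icc (1 / 2 : ℝ) (3 / 2), b t = 0) (hM : ∀ t, |b t| ≤ M)
    (xs : Fin n → Fin d → ℝ) :
    ∃ k : Fin d → Fin m,
      ∑ i, (∏ j, periodize m (k j / m - 1 / 2) b (xs i j)) ^ 2 ≤ n * (M ^ 2) ^ d / m ^ d := by
  have : Nonempty (Fin m) := ⟨⟨0, hm⟩⟩
  have hpt (x : Fin d → ℝ) :
      ∑ k : Fin d → Fin m, (∏ j, periodize m (k j / m - 1 / 2) b (x j)) ^ 2 ≤ (M ^ 2) ^ d := by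
    simp_rw [← Finset.prod_pow]
    have := Finset.prod_univ_sum (fun _ : Fin d => (Finset.univ : Finset (Fin m)))
      fun j i => periodize m (i / m - 1 / 2) b (x j) ^ 2
    rw [Fintype.piFinset_univ] at this
    rw [← this]
    exact (Finset.prod_le_prod (fun _ _ => by positivity)
      fun j _ => sum_periodize_sq_le hsupp hM (x j)).trans_eq (by simp)
  have htot : ∑ k : Fin d → Fin m, ∑ i, (∏ j, periodize m (k j / m - 1 / 2) b (xs i j)) ^ 2 ≤
      ∑ _k : Fin d → Fin m, n * (M ^ 2) ^ d / (m : ℝ) ^ d := by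
    rw [Finset.sum_comm]
    refine (Finset.sum_le_sum fun i _ => hpt (xs i)).trans_eq ?_
    have : (m : ℝ) ≠ 0 := by exact_mod_cast hm.ne'
    simp
    field_simp
  obtain ⟨k, -, hk⟩ := Finset.exists_le_of_sum_le Finset.univ_nonempty htot
  exact ⟨k, hk⟩

theorem exists_periodize_eq {m : ℕ} (i : Fin m) {u : ℝ} (hu : u ∈ Icc (1 / 2 : ℝ) (3 / 2)) :
    ∃ t ∈ Icc (-1 : ℝ) 1, ∀ b : ℝ → ℝ, periodize m (i / m - 1 / 2) b t = b u := by
  have hm : (1 : ℝ) ≤ m := by exact_mod_cast Fin.pos i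
  have hm0 : (0 : ℝ) < m := zero_lt_one.trans_le hm
  have him : (i : ℝ) + 1 ≤ m := by exact_mod_cast i.2
  have hi0 : (0 : ℝ) ≤ i := Nat.cast_nonneg _
  obtain ⟨hu₁, hu₂⟩ := hu
  refine ⟨(2 * i + u) / m - 1, ⟨?_, ?_⟩, fun b => ?_⟩
  · have : 0 ≤ (2 * i + u) / m := by positivity
    linarith
  · have : (2 * i + u) / m ≤ 2 := by
      rw [div_le_iff₀ hm0]
      linarith
    linarith
  · have h : ((2 * i + u) / m - 1) / 2 - (i / m - 1 / 2) = u / (2 * m) := by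
      field_simp
      ring
    rw [periodize, h, Int.fract_eq_self.2 ⟨by positivity, ?_⟩]
    · congr 1
      field_simp
    · rw [div_lt_one (by positivity)]
      linarith

theorem minimax_rate_eq {n ψ σ q ν a δ : ℝ} (hn : 0 < n) (hψ : 0 < ψ) (hσ : 0 < σ)
    (hq : q = 2 * ν + δ) (hq0 : 0 < q) :
    n ^ (-(ν - a) / q) * ψ ^ ((2 * a + δ) / q) * σ ^ ((2 * ν - 2 * a) / q) =
      ψ * ((n * ψ ^ 2 / σ ^ 2) ^ (1 / q)) ^ (-(ν - a)) := by
  obtain ⟨x, rfl⟩ : ∃ x, n = exp x := ⟨log n, (exp_log hn).symm⟩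
  obtain ⟨y, rfl⟩ : ∃ y, ψ = exp y := ⟨log ψ, (exp_log hψ).symm⟩
  obtain ⟨z, rfl⟩ : ∃ z, σ = exp z := ⟨log σ, (exp_log hσ).symm⟩
  simp only [← exp_nat_mul, ← exp_add, ← exp_sub, ← exp_mul]
  congr 1
  have : δ = q - 2 * ν := by linarith
  subst this
  push_cast
  field_simp
  ring

theorem exists_resolution {n : ℕ} {ψ σ q : ℝ} (hσ : 0 < σ) (hq : 0 < q)
    (h : σ ^ 2 ≤ n * ψ ^ 2) :
    ∃ m : ℕ, 1 ≤ m ∧ n * ψ ^ 2 / σ ^ 2 ≤ (m : ℝ) ^ q ∧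
      (m : ℝ) ≤ 2 * (n * ψ ^ 2 / σ ^ 2) ^ (1 / q) := by
  have h1 : 1 ≤ n * ψ ^ 2 / σ ^ 2 := (one_le_div (by positivity)).2 h
  have hR : 1 ≤ (n * ψ ^ 2 / σ ^ 2) ^ (1 / q) := Real.one_le_rpow h1 (by positivity)
  refine ⟨⌈(n * ψ ^ 2 / σ ^ 2) ^ (1 / q)⌉₊, Nat.one_le_ceil_iff.2 (by linarith), ?_, ?_⟩
  · calc n * ψ ^ 2 / σ ^ 2 = ((n * ψ ^ 2 / σ ^ 2) ^ (1 / q)) ^ q := by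
          rw [← Real.rpow_mul (by linarith), one_div_mul_cancel hq.ne', Real.rpow_one]
      _ ≤ _ := by
          gcongr
          exact Nat.le_ceil _
  · linarith [Nat.ceil_lt_add_one (zero_le_one.trans hR)]

open ProbabilityTheory in
/-- Minimax lower bound: for every `d ≥ 1`, `ν > 0` and multi-index `α`
with `|α| ≤ ν*`, there are `c, C₀ > 0` (depending only on `d, ν`) such that for all
`ψ₀, σ > 0` and `n` with `n ψ₀² ≥ C₀ σ²`, for every choice of design points in `[-1,1]^d`
and every measurable estimator producing a continuous estimate of `D^α f` from the `n`
observed responses, there is `f ∈ C_p^ν([-1,1]^d)` with `‖f‖_{C^ν} ≤ ψ₀` such that under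
`Y_i = f(x_i) + ε_i` with `ε_i` i.i.d. `N(0, σ²)`, with probability at least `1/4` the sup
error of the estimate of `D^α f` is at least
`c n^{-(ν-|α|)/(2ν+d)} ψ₀^{(2|α|+d)/(2ν+d)} σ^{(2ν-2|α|)/(2ν+d)}`. -/
theorem minimax_lower_bound (d : ℕ) (hd : 1 ≤ d) (ν : ℝ) (hν : 0 < ν)
    (α : Fin d → ℕ) (hα : (∑ j, α j) ≤ nuStar ν) :
    ∃ c C₀ : ℝ, 0 < c ∧ 0 < C₀ ∧
      ∀ (ψ₀ σ : ℝ) (n : ℕ), 0 < ψ₀ → 0 < σ → C₀ * σ ^ 2 ≤ (n : ℝ) * ψ₀ ^ 2 →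
        ∀ xs : Fin n → (Fin d → ℝ), (∀ i, xs i ∈ box d) →
          ∀ est : (Fin n → ℝ) → ((Fin d → ℝ) → ℝ),
            (∀ x : Fin d → ℝ, Measurable fun y => est y x) →
            (∀ y : Fin n → ℝ, Continuous (est y)) →
            ∃ f : (Fin d → ℝ) → ℝ, MemCpD ν f ∧ CnuNormD ν f ≤ ψ₀ ∧
              (1 / 4 : ENNReal) ≤
                (Measure.pi fun i : Fin n => gaussianReal (f (xs i)) (Real.toNNReal σ ^ 2))
                  {y : Fin n → ℝ |
                    c * (n : ℝ) ^ (-(ν - (∑ j, α j : ℝ)) / (2 * ν + d)) *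
                        ψ₀ ^ ((2 * (∑ j, α j : ℝ) + d) / (2 * ν + d)) *
                        σ ^ ((2 * ν - 2 * (∑ j, α j : ℝ)) / (2 * ν + d)) ≤
                      supBox (fun x => mDeriv α f x - est y x)} := by
  obtain ⟨b, hder, hsupp, hne, hbound⟩ := exists_bump_derivatives
  obtain ⟨M, hM, hbM⟩ := hbound (nuStar ν + 1)
  choose u hu hu0 using hne
  have hd' : (1 : ℝ) ≤ d := by exact_mod_cast hd
  set a : ℝ := ∑ j, (α j : ℝ) with ha
  have ha' : ((∑ j, α j : ℕ) : ℝ) = a := by push_cast; rfl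
  have haν : a < ν := lt_of_le_of_lt (by rw [← ha']; exact_mod_cast hα) (nuStar_lt hν)
  set κ : ℝ := ∏ j, |b (α j) (u (α j))| with hκ
  have hκ0 : 0 < κ := Finset.prod_pos fun j _ => abs_pos.2 (hu0 _)
  set K : ℝ := 2 * d * M ^ (d + 1) with hK
  have hK0 : 0 < K := by positivity
  have hq0 : 0 < 2 * ν + d := by positivity
  refine ⟨κ / (2 * K) * 2 ^ (-(ν - a)), 1, by positivity, one_pos, ?_⟩
  intro ψ σ n hψ hσ hn xs hxs est hest hcont
  rw [one_mul] at hn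
  have hn0 : (0 : ℝ) < n := pos_of_mul_pos_left (lt_of_lt_of_le (by positivity) hn) (by positivity)
  obtain ⟨m, hm, hmlow, hmup⟩ := exists_resolution hσ hq0 hn
  have hm' : (1 : ℝ) ≤ m := by exact_mod_cast hm
  have hm0 : (0 : ℝ) < m := zero_lt_one.trans_le hm'
  obtain ⟨k, hk⟩ := exists_sparse_cell hm (hsupp 0) (hbM 0 (Nat.zero_le _)) xs
  set Φ : Fin d → ℕ → ℝ → ℝ := fun j r => periodize m (k j / m - 1 / 2) (b r) with hΦdef
  have hΦ (j : Fin d) (r : ℕ) (t : ℝ) : HasDerivAt (Φ j r) (m * Φ j (r + 1) t) t :=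
    hasDerivAt_periodize hm' _ (hder r) (hsupp r) t
  have hbd (j : Fin d) (r : ℕ) (hr : r ≤ nuStar ν + 1) (t : ℝ) : |Φ j r t| ≤ M := hbM r hr _
  have hper (j : Fin d) (t : ℝ) : Φ j 0 (t + 2) = Φ j 0 t := periodize_add_two _ _ _ _
  choose z hz hzb using fun j => exists_periodize_eq (k j) (hu (α j))
  have hzbox : z ∈ box d := fun j _ => hz j
  set A : ℝ := ψ * (m : ℝ) ^ (-ν) / K with hA
  have hA0 : 0 < A := by positivity
  set s : ℝ := A * (m : ℝ) ^ a * κ / 2 with hs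
  have hvalue (B : ℝ) : |mDeriv α (fun x => B * ∏ i, Φ i 0 (x i)) z| =
      |B| * (m : ℝ) ^ a * κ := by
    rw [mDeriv_prod hΦ, abs_mul, abs_mul, abs_of_nonneg (pow_nonneg hm0.le _), Finset.abs_prod,
      ← Real.rpow_natCast, ha', hκ]
    simp only [hΦdef, hzb]
  have hthreshold : κ / (2 * K) * 2 ^ (-(ν - a)) * (n : ℝ) ^ (-(ν - a) / (2 * ν + d)) *
      ψ ^ ((2 * a + d) / (2 * ν + d)) * σ ^ ((2 * ν - 2 * a) / (2 * ν + d)) ≤ s := by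
    have hR0 : 0 < (n * ψ ^ 2 / σ ^ 2) ^ (1 / (2 * ν + d)) := by positivity
    have hmul : (2 * (n * ψ ^ 2 / σ ^ 2) ^ (1 / (2 * ν + d))) ^ (-(ν - a)) ≤
        (m : ℝ) ^ (-(ν - a)) :=
      Real.rpow_le_rpow_of_nonpos hm0 hmup (by linarith)
    rw [Real.mul_rpow two_pos.le hR0.le] at hmul
    have hrate := minimax_rate_eq (a := a) hn0 hψ hσ (rfl : 2 * ν + (d : ℝ) = 2 * ν + d) hq0
    calc _ = κ / (2 * K) * 2 ^ (-(ν - a)) * ((n : ℝ) ^ (-(ν - a) / (2 * ν + d)) *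
          ψ ^ ((2 * a + d) / (2 * ν + d)) * σ ^ ((2 * ν - 2 * a) / (2 * ν + d))) := by ring
      _ = κ / (2 * K) * ψ *
          (2 ^ (-(ν - a)) * ((n * ψ ^ 2 / σ ^ 2) ^ (1 / (2 * ν + d))) ^ (-(ν - a))) := by
        rw [hrate]
        ring
      _ ≤ κ / (2 * K) * ψ * (m : ℝ) ^ (-(ν - a)) := by gcongr
      _ = s := by
        rw [show -(ν - a) = -ν + a by ring, Real.rpow_add hm0, hs, hA]
        field_simp
  have hmem (B : ℝ) (hB : |B| ≤ A) := memCpD_prod hd hν hm' hM hΦ hbd hper (A := B) (ψ := ψ) (by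
    calc |B| * (2 * d * M ^ (d + 1)) * (m : ℝ) ^ ν ≤ A * K * (m : ℝ) ^ ν := by gcongr
      _ = ψ * ((m : ℝ) ^ (-ν) * (m : ℝ) ^ ν) := by
        rw [hA]
        field_simp
      _ = ψ := by rw [← Real.rpow_add hm0, neg_add_cancel, Real.rpow_zero, mul_one])
  have hsub (B : ℝ) : {y | s ≤ |mDeriv α (fun x => B * ∏ i, Φ i 0 (x i)) z - est y z|} ⊆
      {y | κ / (2 * K) * 2 ^ (-(ν - a)) * (n : ℝ) ^ (-(ν - a) / (2 * ν + d)) *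
        ψ ^ ((2 * a + d) / (2 * ν + d)) * σ ^ ((2 * ν - 2 * a) / (2 * ν + d)) ≤
        supBox fun x => mDeriv α (fun x => B * ∏ i, Φ i 0 (x i)) x - est y x} := by
    intro y hy
    refine hthreshold.trans (le_trans hy (le_supBox (g := fun x =>
      mDeriv α (fun x => B * ∏ i, Φ i 0 (x i)) x - est y x) ?_ hzbox))
    refine Continuous.sub ?_ (hcont y)
    rw [mDeriv_prod hΦ]
    exact continuous_prod hΦ _ α
  have hv : Real.toNNReal σ ^ 2 ≠ 0 := pow_ne_zero _ (Real.toNNReal_pos.2 hσ).ne'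
  have hv' : ((Real.toNNReal σ ^ 2 : NNReal) : ℝ) = σ ^ 2 := by
    rw [NNReal.coe_pow, Real.coe_toNNReal _ hσ.le]
  have hdist : (∑ i, (A * ∏ j, Φ j 0 (xs i j)) ^ 2) / ((Real.toNNReal σ ^ 2 : NNReal) : ℝ) ≤
      1 / 4 := by
    rw [hv', div_le_iff₀ (by positivity)]
    simp_rw [mul_pow A]
    rw [← Finset.mul_sum]
    have hMK : (M ^ 2) ^ d ≤ K ^ 2 / 4 := by
      have hpow : M ^ d ≤ M ^ (d + 1) := pow_le_pow_right₀ hM (Nat.le_succ _)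
      have hpos : 0 ≤ M ^ d := by positivity
      have : M ^ d ≤ K / 2 := by rw [hK]; nlinarith
      calc (M ^ 2) ^ d = (M ^ d) ^ 2 := by ring
        _ ≤ (K / 2) ^ 2 := by gcongr
        _ = K ^ 2 / 4 := by ring
    have hmd : (m : ℝ) ^ (2 * ν + d) * (((m : ℝ) ^ (-ν)) ^ 2 / (m : ℝ) ^ d) = 1 := by
      rw [Real.rpow_add hm0, Real.rpow_natCast, mul_comm 2 ν, Real.rpow_mul hm0.le,
        Real.rpow_neg hm0.le, Real.rpow_two]
      field_simp
    calc A ^ 2 * ∑ i, (∏ j, Φ j 0 (xs i j)) ^ 2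
        ≤ A ^ 2 * (n * (M ^ 2) ^ d / m ^ d) := by gcongr
      _ ≤ A ^ 2 * (n * (K ^ 2 / 4) / m ^ d) := by gcongr
      _ = n * ψ ^ 2 / σ ^ 2 * (((m : ℝ) ^ (-ν)) ^ 2 / (m : ℝ) ^ d) * (σ ^ 2 / 4) := by
        rw [hA]
        field_simp
      _ ≤ (m : ℝ) ^ (2 * ν + d) * (((m : ℝ) ^ (-ν)) ^ 2 / (m : ℝ) ^ d) * (σ ^ 2 / 4) := by
        gcongr
      _ = 1 / 4 * σ ^ 2 := by
        rw [hmd]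
        ring
  have hcover : {y | s ≤ |mDeriv α (fun x => 0 * ∏ i, Φ i 0 (x i)) z - est y z|} ∪
      {y | s ≤ |mDeriv α (fun x => A * ∏ i, Φ i 0 (x i)) z - est y z|} = univ := by
    refine eq_univ_of_forall fun y => ?_
    by_contra hy
    simp only [mem_union, mem_ofPred_eq, not_or, not_le] at hy
    have h0 := abs_eq_zero.1 ((hvalue 0).trans (by simp))
    have h1 := hvalue A
    rw [abs_of_pos hA0] at h1
    rw [h0, zero_sub, abs_neg] at hy
    have := abs_add_le (mDeriv α (fun x => A * ∏ i, Φ i 0 (x i)) z - est y z) (est y z)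
    rw [sub_add_cancel, h1] at this
    linarith [hy.1, hy.2]
  rcases two_point_gaussian (fun i => A * ∏ j, Φ j 0 (xs i j)) hv hdist
    (measurableSet_le measurable_const (measurable_const.sub (hest z)).abs) hcover with h | h
  · refine ⟨_, (hmem 0 (by simpa using hA0.le)).1, (hmem 0 (by simpa using hA0.le)).2, ?_⟩
    refine le_trans ?_ (measure_mono (hsub 0))
    simp only [zero_mul] at h ⊢
    exact h
  · refine ⟨_, (hmem A (abs_of_pos hA0).le).1, (hmem A (abs_of_pos hA0).le).2, ?_⟩
    exact h.trans (measure_mono (hsub A))
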